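/- Define, for real parameters ρ_d > 0, ρ_i ≥ 0, N_o > 0, σ_e ∈ [0, 1), positive integers U, I, K_D ≥ 1, K_I ≥ 0 with K_D U ρ_d² + K_I I ρ_i² > 0, and variables M ∈ ℕ, N > 0: G(N) = (2/√π) · ((K_D U ρ_d² + K_I I ρ_i²)/N + N_o)^{−1/2} and γ'(M, N) = ρ_d² (1 − σ_e²)(M − U) G(N)² / ( U σ_e² ρ_d² G(N)² + 2 − 4/π + N_o G(N)² ). Then: (i) for fixed N, γ'(M, N) is strictly increasing in M; and (ii) for fixed M > U, γ'(M, N) is strictly increasing in N, i.e., N' > N > 0 implies γ'(M, N') > γ'(M, N). (The paper's claim, drawn from the discussion following Proposition 4, that the approximate SINDR of equation (38) always increases with the number of receive antennas and with the oversampling rate, so that adjacent channel interference can be suppressed by increasing either.) -/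

import Mathlib

/-- The parameter `G(N) = (2/√π)·((K_D U ρ_d² + K_I I ρ_i²)/N + N_o)^{−1/2}`
of Proposition 4. -/
noncomputable def bussgangGain (ρd ρi No : ℝ) (U I KD KI : ℕ) (N : ℝ) : ℝ :=
  (2 / Real.sqrt Real.pi) *
    (((KD : ℝ) * U * ρd ^ 2 + (KI : ℝ) * I * ρi ^ 2) / N + No) ^ (-(1 : ℝ) / 2)

/-- The approximate SINDR `γ'(M, N)` of Proposition 4 (eq. (38)):
`γ' = ρ_d² (1 − σ_e²)(M − U) G² / (U σ_e² ρ_d² G² + 2 − 4/π + N_o G²)`. -/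
noncomputable def approxSINDR (ρd ρi No σe : ℝ) (U I KD KI : ℕ) (M : ℕ) (N : ℝ) : ℝ :=
  ρd ^ 2 * (1 - σe ^ 2) * ((M : ℝ) - (U : ℝ)) * bussgangGain ρd ρi No U I KD KI N ^ 2 /
    ((U : ℝ) * σe ^ 2 * ρd ^ 2 * bussgangGain ρd ρi No U I KD KI N ^ 2
      + 2 - 4 / Real.pi + No * bussgangGain ρd ρi No U I KD KI N ^ 2)

/-- The gain `bussgangGain` is positive. -/
theorem bussgangGain_pos {ρd ρi No : ℝ} {U I KD KI : ℕ} {N : ℝ} (hNo : 0 < No)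
    (hpow : 0 < (KD : ℝ) * U * ρd ^ 2 + (KI : ℝ) * I * ρi ^ 2) (hN : 0 < N) :
    0 < bussgangGain ρd ρi No U I KD KI N := by
  unfold bussgangGain
  have := Real.pi_pos
  positivity

/-- The gain `bussgangGain` is strictly increasing in the DFT size. -/
theorem bussgangGain_lt_bussgangGain {ρd ρi No : ℝ} {U I KD KI : ℕ} {N N' : ℝ} (hNo : 0 < No)
    (hpow : 0 < (KD : ℝ) * U * ρd ^ 2 + (KI : ℝ) * I * ρi ^ 2) (hN : 0 < N) (hNN' : N < N') :
    bussgangGain ρd ρi No U I KD KI N < bussgangGain ρd ρi No U I KD KI N' := by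
  unfold bussgangGain
  have hN' : 0 < N' := hN.trans hNN'
  have hpi := Real.pi_pos
  refine mul_lt_mul_of_pos_left (Real.rpow_lt_rpow_of_neg (by positivity) ?_ (by norm_num))
    (by positivity)
  gcongr

theorem two_sub_four_div_pi_pos : 0 < 2 - 4 / Real.pi := by
  have h : 4 / Real.pi < 2 := by
    rw [div_lt_iff₀ Real.pi_pos]
    linarith [Real.pi_gt_three]
  linarith

/-- The approximate SINDR of Proposition 4 is strictly increasing in the number
of receive antennas `M` (for fixed `N`) and, once `M > U`, strictly increasing
in the DFT size `N` (i.e., in the oversampling rate). -/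
theorem approxSINDR_strictMono_in_antennas_and_oversampling
    (ρd ρi No σe : ℝ) (U I KD KI : ℕ)
    (hρd : 0 < ρd) (hρi : 0 ≤ ρi) (hNo : 0 < No) (hσe0 : 0 ≤ σe) (hσe1 : σe < 1)
    (hU : 1 ≤ U) (hI : 1 ≤ I) (hKD : 1 ≤ KD)
    (hpow : 0 < (KD : ℝ) * U * ρd ^ 2 + (KI : ℝ) * I * ρi ^ 2) :
    (∀ N : ℝ, 0 < N → ∀ M M' : ℕ, M < M' →
        approxSINDR ρd ρi No σe U I KD KI M N < approxSINDR ρd ρi No σe U I KD KI M' N)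
    ∧ (∀ M : ℕ, U < M → ∀ N N' : ℝ, 0 < N → N < N' →
        approxSINDR ρd ρi No σe U I KD KI M N < approxSINDR ρd ρi No σe U I KD KI M N') := by
  have hc := two_sub_four_div_pi_pos
  have hσ : 0 < 1 - σe ^ 2 := by nlinarith
  unfold approxSINDR
  refine ⟨fun N hN M M' hM => ?_, fun M hM N N' hN hNN' => ?_⟩
  · have hG := bussgangGain_pos hNo hpow hN
    set g := bussgangGain ρd ρi No U I KD KI N
    have hden : 0 < (U : ℝ) * σe ^ 2 * ρd ^ 2 * g ^ 2 + 2 - 4 / Real.pi + No * g ^ 2 := by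
      have h₁ : 0 ≤ (U : ℝ) * σe ^ 2 * ρd ^ 2 * g ^ 2 := by positivity
      have h₂ : 0 < No * g ^ 2 := by positivity
      linarith
    have hM' : (M : ℝ) < M' := by exact_mod_cast hM
    gcongr
  · have hG := bussgangGain_pos hNo hpow hN
    have hlt := bussgangGain_lt_bussgangGain hNo hpow hN hNN'
    set g := bussgangGain ρd ρi No U I KD KI N
    set g' := bussgangGain ρd ρi No U I KD KI N'
    have hG' : 0 < g' := hG.trans hlt
    have hden (x : ℝ) (hx : 0 < x) :
        0 < (U : ℝ) * σe ^ 2 * ρd ^ 2 * x ^ 2 + 2 - 4 / Real.pi + No * x ^ 2 := by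
      have h₁ : 0 ≤ (U : ℝ) * σe ^ 2 * ρd ^ 2 * x ^ 2 := by positivity
      have h₂ : 0 < No * x ^ 2 := by positivity
      linarith
    have hMU : 0 < (M : ℝ) - U := sub_pos.mpr (by exact_mod_cast hM)
    have hsq : g ^ 2 < g' ^ 2 := by gcongr
    rw [div_lt_div_iff₀ (hden g hG) (hden g' hG')]
    have h : 0 < ρd ^ 2 * (1 - σe ^ 2) * ((M : ℝ) - U) * (2 - 4 / Real.pi) * (g' ^ 2 - g ^ 2) :=
      mul_pos (by positivity) (sub_pos.mpr hsq)
    linear_combination h
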